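/- Let X and Y be independent centered Gaussian random variables with positive variances. Then for every positive integer r and all nonnegative integers m, n, E[X^{2m} Y^{2n} (X² − Y²)^{2r}] ≥ binom½((m ∧ n) + r, r) · E[X^{2m}] · E[Y^{2n}] · (E[(X+Y)^{2r}])², where m ∧ n denotes min(m, n). Moreover, equality holds if and only if m = n and E[X²] = E[Y²]. -/

import Mathlib

open MeasureTheory ProbabilityTheory
open scoped NNReal

/-- `oddDoubleFactorial n = (2n - 1)!! = 1 * 3 * ⋯ * (2n - 1)`, with `(-1)!! = 1`. -/
def oddDoubleFactorial (n : ℕ) : ℕ := ∏ k ∈ Finset.range n, (2 * k + 1)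

/-- The half-binomial coefficient `binom½(n, k) = (2n-1)!! / ((2n-2k-1)!! (2k-1)!!)`. -/
noncomputable def halfBinom (n k : ℕ) : ℝ :=
  (oddDoubleFactorial n : ℝ) /
    ((oddDoubleFactorial (n - k) : ℝ) * (oddDoubleFactorial k : ℝ))

/-! ### Moments of a difference of scaled gamma variables -/

/-- `diffMoment a b N m n` is the ratio
`E[X^{2m} Y^{2n} (X² - Y²)^N] / (E[X^{2m}] E[Y^{2n}])` for independent centered Gaussian `X, Y`
of variances `a, b`, defined through the recursion in `N` that it satisfies. -/
def diffMoment (a b : ℝ) : ℕ → ℕ → ℕ → ℝ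
  | 0, _, _ => 1
  | N + 1, m, n =>
    a * (2 * m + 1) * diffMoment a b N (m + 1) n - b * (2 * n + 1) * diffMoment a b N m (n + 1)

theorem diffMoment_zero (a b : ℝ) (m n : ℕ) : diffMoment a b 0 m n = 1 := rfl

theorem diffMoment_succ (a b : ℝ) (N m n : ℕ) :
    diffMoment a b (N + 1) m n =
      a * (2 * m + 1) * diffMoment a b N (m + 1) n
        - b * (2 * n + 1) * diffMoment a b N m (n + 1) := rfl

theorem diffMoment_swap (a b : ℝ) (N m n : ℕ) :
    diffMoment a b N m n = (-1) ^ N * diffMoment b a N n m := by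
  induction N generalizing m n with
  | zero => simp [diffMoment_zero]
  | succ N ih =>
    rw [diffMoment_succ, diffMoment_succ, ih (m + 1) n, ih m (n + 1)]
    ring

theorem diffMoment_left_succ (a b : ℝ) (N m n : ℕ) :
    diffMoment a b (N + 1) (m + 1) n =
      diffMoment a b (N + 1) m n + 2 * (N + 1) * a * diffMoment a b N (m + 1) n := by
  induction N generalizing m n with
  | zero => simp only [diffMoment_succ, diffMoment_zero]; push_cast; ring
  | succ N ih =>
    rw [diffMoment_succ a b (N + 1) (m + 1) n, diffMoment_succ a b (N + 1) m n, ih (m + 1) n,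
      ih m (n + 1), diffMoment_succ a b N (m + 1) n]
    push_cast
    ring

theorem diffMoment_right_succ (a b : ℝ) (N m n : ℕ) :
    diffMoment a b (N + 1) m (n + 1) =
      diffMoment a b (N + 1) m n - 2 * (N + 1) * b * diffMoment a b N m (n + 1) := by
  rw [diffMoment_swap a b (N + 1) m (n + 1), diffMoment_left_succ, diffMoment_swap a b _ m n,
    diffMoment_swap a b _ m (n + 1)]
  ring

theorem diffMoment_contiguous (a b : ℝ) (N m n : ℕ) :
    (2 * m + 1) * diffMoment a b N (m + 1) n + (2 * n + 1) * diffMoment a b N m (n + 1) =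
      2 * (m + n + 1 + N) * diffMoment a b N m n := by
  cases N with
  | zero => simp only [diffMoment_zero]; push_cast; ring
  | succ N =>
    rw [diffMoment_left_succ, diffMoment_right_succ, diffMoment_succ a b N m n]
    push_cast
    ring

theorem hasDerivAt_diffMoment (c : ℝ) (N m n : ℕ) (x : ℝ) :
    HasDerivAt (fun e => diffMoment (c + e) (c - e) (N + 1) m n)
      (2 * (N + 1) * (m + n + 1 + N) * diffMoment (c + x) (c - x) N m n) x := by
  have ha : HasDerivAt (fun e : ℝ => c + e) 1 x := (hasDerivAt_id x).const_add c
  have hb : HasDerivAt (fun e : ℝ => c - e) (-1) x := (hasDerivAt_id x).const_sub c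
  induction N generalizing m n with
  | zero =>
    have h := (ha.mul_const (2 * (m : ℝ) + 1)).sub (hb.mul_const (2 * (n : ℝ) + 1))
    simp only [diffMoment_succ, diffMoment_zero, mul_one]
    refine h.congr_deriv ?_
    push_cast
    ring
  | succ N ih =>
    have h := ((ha.mul_const (2 * (m : ℝ) + 1)).mul (ih (m + 1) n)).sub
      ((hb.mul_const (2 * (n : ℝ) + 1)).mul (ih m (n + 1)))
    refine h.congr_deriv ?_
    have h1 := diffMoment_contiguous (c + x) (c - x) (N + 1) m n
    have h2 := diffMoment_succ (c + x) (c - x) N m n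
    push_cast at h1 ⊢
    linear_combination h1 - 2 * (N + 1) * (m + n + 2 + N) * h2

theorem diffMoment_odd_self (c : ℝ) (r n : ℕ) : diffMoment c c (2 * r + 1) n n = 0 := by
  have h := diffMoment_swap c c (2 * r + 1) n n
  rw [Odd.neg_one_pow ⟨r, rfl⟩] at h
  linarith

theorem diffMoment_odd_succ_self (c : ℝ) (r n : ℕ) :
    diffMoment c c (2 * r + 1) (n + 1) n =
      2 * (2 * r + 1) * c * diffMoment c c (2 * r) (n + 1) (n + 1) := by
  have h := diffMoment_right_succ c c (2 * r) (n + 1) n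
  rw [diffMoment_odd_self] at h
  push_cast at h
  linarith

theorem diffMoment_even_self_succ (c : ℝ) (r n : ℕ) :
    diffMoment c c (2 * (r + 1)) n n =
      4 * c ^ 2 * (2 * n + 1) * (2 * r + 1) * diffMoment c c (2 * r) (n + 1) (n + 1) := by
  have h := diffMoment_swap c c (2 * r + 1) n (n + 1)
  rw [Odd.neg_one_pow ⟨r, rfl⟩, diffMoment_odd_succ_self] at h
  rw [show 2 * (r + 1) = 2 * r + 1 + 1 by ring, diffMoment_succ, h, diffMoment_odd_succ_self]
  ring

/-! ### The half-binomial bound -/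

theorem oddDoubleFactorial_succ (n : ℕ) :
    oddDoubleFactorial (n + 1) = oddDoubleFactorial n * (2 * n + 1) :=
  Finset.prod_range_succ _ _

theorem oddDoubleFactorial_pos (n : ℕ) : 0 < oddDoubleFactorial n :=
  Finset.prod_pos fun _ _ => by positivity

theorem halfBinom_add_pos (n r : ℕ) : 0 < halfBinom (n + r) r := by
  have h := oddDoubleFactorial_pos
  have h1 := h (n + r)
  have h2 := h (n + r - r)
  have h3 := h r
  unfold halfBinom
  positivity

theorem halfBinom_succ_mul (n r : ℕ) :
    halfBinom (n + (r + 1)) (r + 1) * (2 * r + 1) =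
      (2 * n + 1) * halfBinom (n + 1 + r) r := by
  have h : ∀ k, (oddDoubleFactorial k : ℝ) ≠ 0 := fun k => by
    exact_mod_cast (oddDoubleFactorial_pos k).ne'
  have h1 := h n
  have h2 := h r
  have h3 : (2 * (n : ℝ) + 1) ≠ 0 := by positivity
  have h4 : (2 * (r : ℝ) + 1) ≠ 0 := by positivity
  unfold halfBinom
  rw [Nat.add_sub_cancel, Nat.add_sub_cancel, oddDoubleFactorial_succ n, oddDoubleFactorial_succ r,
    show n + (r + 1) = n + 1 + r by ring]
  push_cast
  field_simp

theorem diffMoment_even_self (c : ℝ) (r n : ℕ) :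
    diffMoment c c (2 * r) n n =
      halfBinom (n + r) r * ((2 * c) ^ r * oddDoubleFactorial r) ^ 2 := by
  induction r generalizing n with
  | zero =>
    have h : (oddDoubleFactorial n : ℝ) ≠ 0 := by exact_mod_cast (oddDoubleFactorial_pos n).ne'
    simpa [diffMoment_zero, halfBinom, oddDoubleFactorial] using (div_self h).symm
  | succ r ih =>
    rw [diffMoment_even_self_succ, ih, oddDoubleFactorial_succ]
    push_cast
    linear_combination (-4 * c ^ 2 * (2 * r + 1) * ((2 * c) ^ r * oddDoubleFactorial r) ^ 2) *
      halfBinom_succ_mul n r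

/-! ### Minimizing over the variances -/

theorem lt_of_hasDerivAt_mul_strictMono {f g : ℝ → ℝ} {K : ℝ} (hK : 0 < K)
    (hf : ∀ x, HasDerivAt f (K * g x) x) (hg : StrictMono g) {x₀ : ℝ} (h₀ : g x₀ = 0)
    {x : ℝ} (hx : x ≠ x₀) : f x₀ < f x := by
  have hc : Continuous f := continuous_iff_continuousAt.2 fun y => (hf y).continuousAt
  rcases lt_or_gt_of_ne hx with hlt | hlt
  · obtain ⟨y, hy, hy'⟩ := exists_hasDerivAt_eq_slope f _ hlt hc.continuousOn fun z _ => hf z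
    have h1 : g y < 0 := h₀ ▸ hg hy.2
    rw [eq_div_iff (sub_pos.2 hlt).ne'] at hy'
    nlinarith [mul_pos (mul_pos hK (neg_pos.2 h1)) (sub_pos.2 hlt)]
  · obtain ⟨y, hy, hy'⟩ := exists_hasDerivAt_eq_slope f _ hlt hc.continuousOn fun z _ => hf z
    have h1 : 0 < g y := h₀ ▸ hg hy.1
    rw [eq_div_iff (sub_pos.2 hlt).ne'] at hy'
    nlinarith [mul_pos (mul_pos hK h1) (sub_pos.2 hlt)]

theorem strictMono_and_exists_zero_of_le_deriv {g g' : ℝ → ℝ} {δ : ℝ} (hδ : 0 < δ)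
    (hg : ∀ x, HasDerivAt g (g' x) x) (h : ∀ x, δ ≤ g' x) :
    StrictMono g ∧ ∃ x₀, g x₀ = 0 := by
  have hd : Differentiable ℝ g := fun x => (hg x).differentiableAt
  have hle : ∀ x, δ ≤ deriv g x := fun x => (hg x).deriv ▸ h x
  have hgrow := mul_sub_le_image_sub_of_le_deriv hd hle
  refine ⟨strictMono_of_deriv_pos fun x => hδ.trans_le (hle x), ?_⟩
  have hM : 0 ≤ |g 0| / δ := by positivity
  have hcancel : δ * (|g 0| / δ) = |g 0| := mul_div_cancel₀ _ hδ.ne'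
  have h1 := hgrow hM
  have h2 := hgrow (neg_nonpos.2 hM)
  have h3 : g (-(|g 0| / δ)) ≤ 0 := by linarith [le_abs_self (g 0)]
  have h4 : 0 ≤ g (|g 0| / δ) := by linarith [neg_abs_le (g 0)]
  exact mem_range_of_exists_le_of_exists_ge hd.continuous ⟨_, h3⟩ ⟨_, h4⟩

theorem strictMono_diffMoment_odd (c : ℝ) {r m n : ℕ} {δ : ℝ} (hδ : 0 < δ)
    (h : ∀ e, δ ≤ diffMoment (c + e) (c - e) (2 * r) m n) :
    StrictMono (fun e => diffMoment (c + e) (c - e) (2 * r + 1) m n) ∧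
      ∃ e, diffMoment (c + e) (c - e) (2 * r + 1) m n = 0 := by
  have hK : 0 < 2 * (((2 * r : ℕ) : ℝ) + 1) * (m + n + 1 + (2 * r : ℕ)) := by positivity
  exact strictMono_and_exists_zero_of_le_deriv (mul_pos hK hδ)
    (hasDerivAt_diffMoment c (2 * r) m n) fun x => mul_le_mul_of_nonneg_left (h x) hK.le

theorem diffMoment_even_lt (c : ℝ) {r m n : ℕ} {δ : ℝ} (hδ : 0 < δ)
    (h : ∀ e, δ ≤ diffMoment (c + e) (c - e) (2 * r) m n) {e₀ e : ℝ}
    (h₀ : diffMoment (c + e₀) (c - e₀) (2 * r + 1) m n = 0) (he : e ≠ e₀) :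
    diffMoment (c + e₀) (c - e₀) (2 * r + 1 + 1) m n <
      diffMoment (c + e) (c - e) (2 * r + 1 + 1) m n := by
  have hK : 0 < 2 * (((2 * r + 1 : ℕ) : ℝ) + 1) * (m + n + 1 + (2 * r + 1 : ℕ)) := by positivity
  exact lt_of_hasDerivAt_mul_strictMono
    (f := fun e => diffMoment (c + e) (c - e) (2 * r + 1 + 1) m n) hK
    (hasDerivAt_diffMoment c (2 * r + 1) m n) (strictMono_diffMoment_odd c hδ h).1 h₀ he

theorem diffMoment_even_add_bounds {c : ℝ} (hc : 0 < c) {r : ℕ}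
    (hpos : ∀ m n, ∃ δ, 0 < δ ∧ ∀ e, δ ≤ diffMoment (c + e) (c - e) (2 * r) m n) (n k : ℕ) (e : ℝ) :
    diffMoment c c (2 * (r + 1)) n n ≤ diffMoment (c + e) (c - e) (2 * (r + 1)) (n + k) n ∧
      (diffMoment c c (2 * (r + 1)) n n = diffMoment (c + e) (c - e) (2 * (r + 1)) (n + k) n →
        k = 0 ∧ e = 0) := by
  rw [show 2 * (r + 1) = 2 * r + 1 + 1 by ring]
  have base : ∀ e, e ≠ 0 → diffMoment c c (2 * r + 1 + 1) n n <
      diffMoment (c + e) (c - e) (2 * r + 1 + 1) n n := by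
    intro e he
    obtain ⟨δ, hδ, h⟩ := hpos n n
    simpa using diffMoment_even_lt c hδ h (e₀ := 0) (by simp [diffMoment_odd_self]) he
  induction k generalizing e with
  | zero =>
    rcases eq_or_ne e 0 with rfl | he
    · simp
    · exact ⟨(base e he).le, fun h => absurd h (base e he).ne⟩
  | succ k ih =>
    obtain ⟨δ, hδ, h⟩ := hpos (n + k + 1) n
    obtain ⟨e₀, h₀⟩ := (strictMono_diffMoment_odd c hδ h).2
    have hstep := diffMoment_left_succ (c + e₀) (c - e₀) (2 * r + 1) (n + k) n
    rw [h₀, mul_zero, add_zero] at hstep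
    have hlt : diffMoment c c (2 * r + 1 + 1) n n <
        diffMoment (c + e₀) (c - e₀) (2 * r + 1 + 1) (n + k) n := by
      refine (ih e₀).1.lt_of_ne fun heq => ?_
      obtain ⟨rfl, rfl⟩ := (ih e₀).2 heq
      obtain ⟨δ', hδ', h'⟩ := hpos (n + 1) (n + 1)
      have h1 := h' 0
      simp only [add_zero, sub_zero] at h₀ h1
      rw [diffMoment_odd_succ_self] at h₀
      have h2 : 0 < diffMoment c c (2 * r) (n + 1) (n + 1) := hδ'.trans_le h1
      exact absurd h₀ (by positivity)
    have hmin : diffMoment (c + e₀) (c - e₀) (2 * r + 1 + 1) (n + k + 1) n ≤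
        diffMoment (c + e) (c - e) (2 * r + 1 + 1) (n + k + 1) n := by
      rcases eq_or_ne e e₀ with rfl | he
      · exact le_rfl
      · exact (diffMoment_even_lt c hδ h h₀ he).le
    have hfin := (hstep ▸ hlt).trans_le hmin
    exact ⟨hfin.le, fun heq => absurd heq hfin.ne⟩

theorem diffMoment_even_bounds_of_pos {c : ℝ} (hc : 0 < c) {r : ℕ}
    (hpos : ∀ m n, ∃ δ, 0 < δ ∧ ∀ e, δ ≤ diffMoment (c + e) (c - e) (2 * r) m n) (m n : ℕ) (e : ℝ) :
    diffMoment c c (2 * (r + 1)) (min m n) (min m n) ≤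
        diffMoment (c + e) (c - e) (2 * (r + 1)) m n ∧
      (diffMoment c c (2 * (r + 1)) (min m n) (min m n) =
        diffMoment (c + e) (c - e) (2 * (r + 1)) m n → m = n ∧ e = 0) := by
  rcases le_total n m with hmn | hmn
  · obtain ⟨k, rfl⟩ := Nat.exists_eq_add_of_le hmn
    have h := diffMoment_even_add_bounds hc hpos n k e
    rw [min_eq_right hmn]
    exact ⟨h.1, fun heq => ⟨by simp [(h.2 heq).1], (h.2 heq).2⟩⟩
  · obtain ⟨k, rfl⟩ := Nat.exists_eq_add_of_le hmn
    have h := diffMoment_even_add_bounds hc hpos m k (-e)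
    rw [min_eq_left hmn, diffMoment_swap (c + e), Even.neg_one_pow ⟨r + 1, by ring⟩, one_mul]
    rw [sub_neg_eq_add, ← sub_eq_add_neg] at h
    exact ⟨h.1, fun heq => ⟨by simp [(h.2 heq).1], neg_eq_zero.1 (h.2 heq).2⟩⟩

theorem exists_pos_le_diffMoment_even {c : ℝ} (hc : 0 < c) (r m n : ℕ) :
    ∃ δ, 0 < δ ∧ ∀ e, δ ≤ diffMoment (c + e) (c - e) (2 * r) m n := by
  induction r generalizing m n with
  | zero => exact ⟨1, one_pos, fun e => (diffMoment_zero _ _ _ _).ge⟩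
  | succ r ih =>
    refine ⟨_, ?_, fun e => (diffMoment_even_bounds_of_pos hc ih m n e).1⟩
    have h1 := halfBinom_add_pos (min m n) (r + 1)
    have h2 := oddDoubleFactorial_pos (r + 1)
    rw [diffMoment_even_self]
    positivity

theorem halfBinom_le_diffMoment {a b : ℝ} (ha : 0 < a) (hb : 0 < b) {r : ℕ} (hr : 0 < r)
    (m n : ℕ) :
    halfBinom (min m n + r) r * ((a + b) ^ r * oddDoubleFactorial r) ^ 2 ≤
        diffMoment a b (2 * r) m n ∧
      (diffMoment a b (2 * r) m n =
        halfBinom (min m n + r) r * ((a + b) ^ r * oddDoubleFactorial r) ^ 2 ↔ m = n ∧ a = b) := by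
  obtain ⟨r, rfl⟩ := Nat.exists_eq_succ_of_ne_zero hr.ne'
  have hc : 0 < (a + b) / 2 := by positivity
  have h := diffMoment_even_bounds_of_pos hc (exists_pos_le_diffMoment_even hc r) m n ((a - b) / 2)
  rw [diffMoment_even_self, show 2 * ((a + b) / 2) = a + b by ring,
    show (a + b) / 2 + (a - b) / 2 = a by ring, show (a + b) / 2 - (a - b) / 2 = b by ring] at h
  refine ⟨h.1, fun heq => ?_, ?_⟩
  · obtain ⟨h1, h2⟩ := h.2 heq.symm
    exact ⟨h1, by linarith⟩
  · rintro ⟨rfl, rfl⟩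
    rw [min_self, diffMoment_even_self, two_mul]

/-! ### Gaussian moments -/

theorem integrable_pow_gaussianReal (v : ℝ≥0) (k : ℕ) :
    Integrable (fun x : ℝ => x ^ k) (gaussianReal 0 v) := by
  have h := memLp_id_gaussianReal' (μ := 0) (v := v) k (by simp)
  exact (integrable_norm_iff (by fun_prop)).1 (by simpa using h.integrable_norm_pow')

theorem hasDerivAt_gaussianPDFReal_zero (v : ℝ≥0) (x : ℝ) :
    HasDerivAt (gaussianPDFReal 0 v) (-(x / v) * gaussianPDFReal 0 v x) x := by
  have h := ((((hasDerivAt_id x).pow 2).neg.div_const (2 * (v : ℝ))).exp).const_mul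
    (√(2 * Real.pi * v))⁻¹
  simp only [gaussianPDFReal_def, sub_zero]
  refine h.congr_deriv ?_
  simp
  ring

theorem integral_pow_add_two_gaussianReal {v : ℝ≥0} (hv : v ≠ 0) (k : ℕ) :
    ∫ x, x ^ (k + 2) ∂gaussianReal 0 v = v * (k + 1) * ∫ x, x ^ k ∂gaussianReal 0 v := by
  have hv' : (v : ℝ) ≠ 0 := by exact_mod_cast hv
  have hint : ∀ j : ℕ, Integrable fun x : ℝ => x ^ j * gaussianPDFReal 0 v x := fun j => by
    have h := integrable_pow_gaussianReal v j
    rw [gaussianReal_of_var_ne_zero _ hv, integrable_withDensity_iff (measurable_gaussianPDF _ _)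
      (ae_of_all _ fun _ => gaussianPDF_lt_top)] at h
    simpa using h
  have hparts := integral_mul_deriv_eq_deriv_mul_of_integrable
    (u := fun x : ℝ => x ^ (k + 1)) (u' := fun x => ((k + 1 : ℕ) : ℝ) * x ^ k)
    (v := gaussianPDFReal 0 v) (v' := fun x => -(x / v) * gaussianPDFReal 0 v x)
    (fun x _ => by simpa using hasDerivAt_pow (k + 1) x)
    (fun x _ => hasDerivAt_gaussianPDFReal_zero v x)
    (((hint (k + 2)).const_mul (-(v : ℝ)⁻¹)).congr (ae_of_all _ fun x => by
      simp only [Pi.mul_apply]; ring))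
    (((hint k).const_mul ((k + 1 : ℕ) : ℝ)).congr (ae_of_all _ fun x => by
      simp only [Pi.mul_apply]; ring))
    (hint (k + 1))
  rw [integral_gaussianReal_eq_integral_smul hv, integral_gaussianReal_eq_integral_smul hv]
  have h1 : ∫ x : ℝ, x ^ (k + 1) * (-(x / v) * gaussianPDFReal 0 v x) =
      -(v : ℝ)⁻¹ * ∫ x : ℝ, gaussianPDFReal 0 v x • x ^ (k + 2) := by
    rw [← integral_const_mul]
    refine integral_congr_ae (ae_of_all _ fun x => ?_)
    simp only [smul_eq_mul]
    ring
  have h2 : ∫ x : ℝ, ((k + 1 : ℕ) : ℝ) * x ^ k * gaussianPDFReal 0 v x =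
      (k + 1) * ∫ x : ℝ, gaussianPDFReal 0 v x • x ^ k := by
    rw [← integral_const_mul]
    refine integral_congr_ae (ae_of_all _ fun x => ?_)
    simp only [smul_eq_mul]
    push_cast
    ring
  rw [h1, h2] at hparts
  field_simp at hparts
  linarith

theorem integral_pow_even_gaussianReal {v : ℝ≥0} (hv : v ≠ 0) (k : ℕ) :
    ∫ x, x ^ (2 * k) ∂gaussianReal 0 v = v ^ k * oddDoubleFactorial k := by
  induction k with
  | zero => simp [oddDoubleFactorial]
  | succ k ih =>
    rw [show 2 * (k + 1) = 2 * k + 2 by ring, integral_pow_add_two_gaussianReal hv, ih,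
      oddDoubleFactorial_succ]
    push_cast
    ring

section Laws

variable {Ω : Type*} [MeasurableSpace Ω] {P : Measure Ω} {X Y : Ω → ℝ} {vX vY : ℝ≥0}

theorem aemeasurable_of_map_eq_gaussianReal (hX : Measure.map X P = gaussianReal 0 vX) :
    AEMeasurable X P :=
  AEMeasurable.of_map_ne_zero (by simp [NeZero.ne, hX])

theorem integrable_pow_of_map_eq_gaussianReal (hX : Measure.map X P = gaussianReal 0 vX) (k : ℕ) :
    Integrable (fun ω => X ω ^ k) P := by
  have h := integrable_pow_gaussianReal vX k
  rw [← hX] at h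
  exact h.comp_aemeasurable (aemeasurable_of_map_eq_gaussianReal hX)

theorem integral_pow_even_of_map_eq_gaussianReal (hv : vX ≠ 0)
    (hX : Measure.map X P = gaussianReal 0 vX) (k : ℕ) :
    ∫ ω, X ω ^ (2 * k) ∂P = vX ^ k * oddDoubleFactorial k := by
  rw [← integral_pow_even_gaussianReal hv, ← hX,
    integral_map (aemeasurable_of_map_eq_gaussianReal hX) (by fun_prop)]

theorem integrable_pow_mul_pow_mul_sub_pow (hX : Measure.map X P = gaussianReal 0 vX)
    (hY : Measure.map Y P = gaussianReal 0 vY) (hindep : IndepFun X Y P) (N m n : ℕ) :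
    Integrable (fun ω => X ω ^ (2 * m) * Y ω ^ (2 * n) * (X ω ^ 2 - Y ω ^ 2) ^ N) P := by
  induction N generalizing m n with
  | zero =>
    have h := (hindep.comp (φ := fun x : ℝ => x ^ (2 * m)) (ψ := fun y : ℝ => y ^ (2 * n))
      (by fun_prop) (by fun_prop)).integrable_mul
      (integrable_pow_of_map_eq_gaussianReal hX _) (integrable_pow_of_map_eq_gaussianReal hY _)
    refine h.congr (ae_of_all _ fun ω => ?_)
    simp
  | succ N ih =>
    refine ((ih (m + 1) n).sub (ih m (n + 1))).congr (ae_of_all _ fun ω => ?_)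
    simp only [Pi.sub_apply]
    ring

theorem integral_pow_mul_pow_mul_sub_pow (hvX : vX ≠ 0) (hvY : vY ≠ 0)
    (hX : Measure.map X P = gaussianReal 0 vX) (hY : Measure.map Y P = gaussianReal 0 vY)
    (hindep : IndepFun X Y P) (N m n : ℕ) :
    ∫ ω, X ω ^ (2 * m) * Y ω ^ (2 * n) * (X ω ^ 2 - Y ω ^ 2) ^ N ∂P =
      (∫ ω, X ω ^ (2 * m) ∂P) * (∫ ω, Y ω ^ (2 * n) ∂P) * diffMoment vX vY N m n := by
  induction N generalizing m n with
  | zero =>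
    simp only [pow_zero, mul_one, diffMoment_zero]
    exact hindep.integral_fun_comp_mul_comp (f := fun x : ℝ => x ^ (2 * m))
      (g := fun y : ℝ => y ^ (2 * n)) (aemeasurable_of_map_eq_gaussianReal hX)
      (aemeasurable_of_map_eq_gaussianReal hY) (by fun_prop) (by fun_prop)
  | succ N ih =>
    have hsplit : ∀ ω, X ω ^ (2 * m) * Y ω ^ (2 * n) * (X ω ^ 2 - Y ω ^ 2) ^ (N + 1) =
        X ω ^ (2 * (m + 1)) * Y ω ^ (2 * n) * (X ω ^ 2 - Y ω ^ 2) ^ N -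
          X ω ^ (2 * m) * Y ω ^ (2 * (n + 1)) * (X ω ^ 2 - Y ω ^ 2) ^ N := fun ω => by ring
    simp_rw [hsplit]
    rw [integral_sub (integrable_pow_mul_pow_mul_sub_pow hX hY hindep N (m + 1) n)
      (integrable_pow_mul_pow_mul_sub_pow hX hY hindep N m (n + 1)), ih, ih, diffMoment_succ]
    simp only [integral_pow_even_of_map_eq_gaussianReal hvX hX,
      integral_pow_even_of_map_eq_gaussianReal hvY hY, oddDoubleFactorial_succ]
    push_cast
    ring

end Laws

/-- For independent centered Gaussian `X, Y` with positive variances, a positive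
integer `r` and nonnegative integers `m, n`:
`E[X^{2m} Y^{2n} (X² - Y²)^{2r}] ≥ binom½(min m n + r, r) E[X^{2m}] E[Y^{2n}] (E[(X+Y)^{2r}])²`,
with equality iff `m = n` and `E[X²] = E[Y²]`. -/
theorem gaussian_product_inequality_diff_squares
    {Ω : Type*} [MeasurableSpace Ω] (P : Measure Ω) [IsProbabilityMeasure P]
    (X Y : Ω → ℝ) (vX vY : ℝ≥0) (hvX : 0 < vX) (hvY : 0 < vY)
    (hX : Measure.map X P = gaussianReal 0 vX)
    (hY : Measure.map Y P = gaussianReal 0 vY)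
    (hindep : IndepFun X Y P)
    (m n r : ℕ) (hr : 0 < r) :
    (∫ ω, (X ω) ^ (2 * m) * (Y ω) ^ (2 * n) * ((X ω) ^ 2 - (Y ω) ^ 2) ^ (2 * r) ∂P)
        ≥ halfBinom (min m n + r) r *
            ((∫ ω, (X ω) ^ (2 * m) ∂P) * (∫ ω, (Y ω) ^ (2 * n) ∂P)
              * (∫ ω, (X ω + Y ω) ^ (2 * r) ∂P) ^ 2)
      ∧ ((∫ ω, (X ω) ^ (2 * m) * (Y ω) ^ (2 * n) * ((X ω) ^ 2 - (Y ω) ^ 2) ^ (2 * r) ∂P)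
            = halfBinom (min m n + r) r *
                ((∫ ω, (X ω) ^ (2 * m) ∂P) * (∫ ω, (Y ω) ^ (2 * n) ∂P)
                  * (∫ ω, (X ω + Y ω) ^ (2 * r) ∂P) ^ 2)
          ↔ m = n ∧ (∫ ω, (X ω) ^ 2 ∂P) = (∫ ω, (Y ω) ^ 2 ∂P)) := by
  have hvX' := hvX.ne'
  have hvY' := hvY.ne'
  have hsum : Measure.map (fun ω => X ω + Y ω) P = gaussianReal 0 (vX + vY) := by
    have h := gaussianReal_add_gaussianReal_of_indepFun hindep hX hY
    rwa [add_zero] at h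
  have hsq : (∫ ω, X ω ^ 2 ∂P) = ∫ ω, Y ω ^ 2 ∂P ↔ (vX : ℝ) = vY := by
    have h1 := integral_pow_even_of_map_eq_gaussianReal hvX' hX 1
    have h2 := integral_pow_even_of_map_eq_gaussianReal hvY' hY 1
    simp only [mul_one] at h1 h2
    rw [h1, h2]
    simp [oddDoubleFactorial]
  have hpos : 0 < (∫ ω, X ω ^ (2 * m) ∂P) * ∫ ω, Y ω ^ (2 * n) ∂P := by
    have h1 := oddDoubleFactorial_pos m
    have h2 := oddDoubleFactorial_pos n
    rw [integral_pow_even_of_map_eq_gaussianReal hvX' hX,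
      integral_pow_even_of_map_eq_gaussianReal hvY' hY]
    positivity
  obtain ⟨hle, heq⟩ := halfBinom_le_diffMoment (NNReal.coe_pos.2 hvX) (NNReal.coe_pos.2 hvY) hr m n
  rw [hsq, ← heq, integral_pow_mul_pow_mul_sub_pow hvX' hvY' hX hY hindep,
    integral_pow_even_of_map_eq_gaussianReal (add_pos hvX hvY).ne' hsum, NNReal.coe_add,
    mul_left_comm (halfBinom _ _)]
  exact ⟨mul_le_mul_of_nonneg_left hle hpos.le, mul_right_inj' hpos.ne'⟩
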